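/- Let Ω' ⊆ ℂ be a nonempty bounded open set, let r ≥ 2 be a real number, and let p be a real number with 2r/(r+2) < p < 2. Then for every C^∞ function f : ℂ → ℝ whose topological support is a compact subset of Ω', one has (∫_{Ω'} |f(x)|^r dx)^{1/r} ≤ C(p,r,Ω') · (∫_{Ω'} ‖Df(x)‖² dx)^{1/2}, where C(p,r,Ω') = ((p−1)/(2−p))^{(p−1)/p} · (volume Ω')^{1/r} / (√π · 2^{1/p} · √(Γ(2/p) · Γ(3−2/p))). -/

import Mathlib

open MeasureTheory Real

/-- The monotone rearrangement on the line: `monotoneTransport g n h R` carries the density `h` on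
`[-R, R]` to the multiple of the density `g` on `[-n, n]` with the same total mass. -/
noncomputable def monotoneTransport (g : ℝ → ℝ) (n : ℝ) (h : ℝ → ℝ) (R y : ℝ) : ℝ :=
  Classical.epsilon fun u => u ∈ Set.Icc (-n) n ∧ ∫ v in (-n)..u, g v =
    (∫ v in (-n)..n, g v) / (∫ t in (-R)..R, h t) * ∫ t in (-R)..y, h t

section Transport

variable {g h : ℝ → ℝ} {n R : ℝ}

theorem intervalIntegral_mem_Icc_of_support_subset (hR : 0 < R) (hh : Continuous h)
    (h0 : ∀ t, 0 ≤ h t) (hs : ∀ t, t ∉ Set.Ioo (-R) R → h t = 0) (y : ℝ) :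
    ∫ t in (-R)..y, h t ∈ Set.Icc 0 (∫ t in (-R)..R, h t) := by
  have hi : ∀ a b, IntervalIntegrable h volume a b := fun a b => hh.intervalIntegrable a b
  rcases le_total y (-R) with hy | hy
  · have : ∫ t in (-R)..y, h t = 0 := by
      apply intervalIntegral.integral_zero_ae
      refine Filter.Eventually.of_forall fun t ht => hs t ?_
      rw [Set.uIoc_of_ge hy] at ht
      exact fun h' => absurd ht.2 (not_le.2 h'.1)
    rw [this]
    exact ⟨le_rfl, intervalIntegral.integral_nonneg (by linarith) fun t _ => h0 t⟩
  refine ⟨intervalIntegral.integral_nonneg hy fun t _ => h0 t, ?_⟩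
  rw [← intervalIntegral.integral_add_adjacent_intervals (hi (-R) y) (hi y R)]
  rcases le_total y R with hy' | hy'
  · linarith [intervalIntegral.integral_nonneg (μ := volume) hy' fun t _ => h0 t]
  · have : ∫ t in y..R, h t = 0 := by
      apply intervalIntegral.integral_zero_ae
      refine Filter.Eventually.of_forall fun t ht => hs t ?_
      rw [Set.uIoc_of_ge hy'] at ht
      exact fun h' => absurd ht.1 (not_lt.2 h'.2.le)
    rw [this, add_zero]

theorem strictMono_intervalIntegral (hg : Continuous g) (hpos : ∀ u, 0 < g u) (a : ℝ) :
    StrictMono fun u => ∫ v in a..u, g v := by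
  intro u v huv
  have hi : ∀ a b, IntervalIntegrable g volume a b := fun a b => hg.intervalIntegrable a b
  have := intervalIntegral.intervalIntegral_pos_of_pos (hi u v) hpos huv
  simp only
  rw [← intervalIntegral.integral_add_adjacent_intervals (hi a u) (hi u v)]
  linarith

theorem monotoneTransport_spec (hg : Continuous g) (hpos : ∀ u, 0 < g u) (hn : 0 < n)
    (hR : 0 < R) (hh : Continuous h) (h0 : ∀ t, 0 ≤ h t)
    (hs : ∀ t, t ∉ Set.Ioo (-R) R → h t = 0) (y : ℝ) :
    monotoneTransport g n h R y ∈ Set.Icc (-n) n ∧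
      ∫ v in (-n)..(monotoneTransport g n h R y), g v =
        (∫ v in (-n)..n, g v) / (∫ t in (-R)..R, h t) * ∫ t in (-R)..y, h t := by
  refine Classical.epsilon_spec (p := fun u => u ∈ Set.Icc (-n) n ∧ ∫ v in (-n)..u, g v =
    (∫ v in (-n)..n, g v) / (∫ t in (-R)..R, h t) * ∫ t in (-R)..y, h t) ?_
  have hc : Continuous fun u => ∫ v in (-n)..u, g v :=
    continuous_iff_continuousAt.2 fun u =>
      (hg.integral_hasStrictDerivAt (-n) u).hasDerivAt.continuousAt
  have hm : 0 ≤ ∫ v in (-n)..n, g v :=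
    intervalIntegral.integral_nonneg (by linarith) fun t _ => (hpos t).le
  obtain ⟨h1, h2⟩ := intervalIntegral_mem_Icc_of_support_subset hR hh h0 hs y
  have key := intermediate_value_Icc (by linarith : -n ≤ n) hc.continuousOn
  obtain ⟨u, hu, hu'⟩ := key (show (∫ v in (-n)..n, g v) / (∫ t in (-R)..R, h t) *
    ∫ t in (-R)..y, h t ∈ _ by
      rw [intervalIntegral.integral_same]
      refine ⟨by have := h1.trans h2; positivity, ?_⟩
      rw [div_mul_eq_mul_div, mul_div_assoc]
      exact mul_le_of_le_one_right hm (div_le_one_of_le₀ h2 (h1.trans h2)))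
  exact ⟨u, hu, hu'⟩

theorem continuous_monotoneTransport (hg : Continuous g) (hpos : ∀ u, 0 < g u) (hn : 0 < n)
    (hR : 0 < R) (hh : Continuous h) (h0 : ∀ t, 0 ≤ h t)
    (hs : ∀ t, t ∉ Set.Ioo (-R) R → h t = 0) : Continuous (monotoneTransport g n h R) := by
  have hc : Continuous fun u => ∫ v in (-n)..u, g v :=
    continuous_iff_continuousAt.2 fun u =>
      (hg.integral_hasStrictDerivAt (-n) u).hasDerivAt.continuousAt
  have he := (strictMono_intervalIntegral hg hpos (-n)).isEmbedding_of_ordConnected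
    (isPreconnected_range hc).ordConnected
  rw [he.continuous_iff]
  have : ((fun u => ∫ v in (-n)..u, g v) ∘ monotoneTransport g n h R) = fun y =>
      (∫ v in (-n)..n, g v) / (∫ t in (-R)..R, h t) * ∫ t in (-R)..y, h t :=
    funext fun y => (monotoneTransport_spec hg hpos hn hR hh h0 hs y).2
  rw [this]
  exact continuous_const.mul (continuous_iff_continuousAt.2 fun u =>
    (hh.integral_hasStrictDerivAt (-R) u).hasDerivAt.continuousAt)

theorem hasDerivAt_monotoneTransport (hg : Continuous g) (hpos : ∀ u, 0 < g u) (hn : 0 < n)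
    (hR : 0 < R) (hh : Continuous h) (h0 : ∀ t, 0 ≤ h t)
    (hs : ∀ t, t ∉ Set.Ioo (-R) R → h t = 0) (y : ℝ) :
    HasDerivAt (monotoneTransport g n h R)
      ((∫ v in (-n)..n, g v) / (∫ t in (-R)..R, h t) * h y / g (monotoneTransport g n h R y))
      y := by
  set T := monotoneTransport g n h R with hT
  have hspec := monotoneTransport_spec hg hpos hn hR hh h0 hs
  have hst := hg.integral_hasStrictDerivAt (-n) (T y)
  have hinv := (hst.to_localInverse (hpos _).ne').hasDerivAt
  have hleft := hst.eventually_left_inverse (hpos _).ne'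
  have hcont : ContinuousAt T y :=
    (continuous_monotoneTransport hg hpos hn hR hh h0 hs).continuousAt
  have hev := hcont.eventually hleft
  have hcdf : HasDerivAt (fun y => ∫ v in (-n)..(T y), g v)
      ((∫ v in (-n)..n, g v) / (∫ t in (-R)..R, h t) * h y) y := by
    have : (fun y => ∫ v in (-n)..(T y), g v) = fun y =>
        (∫ v in (-n)..n, g v) / (∫ t in (-R)..R, h t) * ∫ t in (-R)..y, h t :=
      funext fun y => (hspec y).2
    rw [this]
    exact (hh.integral_hasStrictDerivAt (-R) y).hasDerivAt.const_mul _
  have := hinv.comp y hcdf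
  refine (this.congr_of_eventuallyEq ?_).congr_deriv (div_eq_inv_mul _ _).symm
  filter_upwards [hev] with z hz
  exact hz.symm

theorem monotoneTransport_left (hg : Continuous g) (hpos : ∀ u, 0 < g u) (hn : 0 < n)
    (hR : 0 < R) (hh : Continuous h) (h0 : ∀ t, 0 ≤ h t)
    (hs : ∀ t, t ∉ Set.Ioo (-R) R → h t = 0) : monotoneTransport g n h R (-R) = -n := by
  have := (monotoneTransport_spec hg hpos hn hR hh h0 hs (-R)).2
  rw [intervalIntegral.integral_same, mul_zero] at this
  apply (strictMono_intervalIntegral hg hpos (-n)).injective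
  simp [this]

theorem monotoneTransport_right (hg : Continuous g) (hpos : ∀ u, 0 < g u) (hn : 0 < n)
    (hR : 0 < R) (hh : Continuous h) (h0 : ∀ t, 0 ≤ h t)
    (hs : ∀ t, t ∉ Set.Ioo (-R) R → h t = 0) (hN : ∫ t in (-R)..R, h t ≠ 0) :
    monotoneTransport g n h R R = n := by
  have := (monotoneTransport_spec hg hpos hn hR hh h0 hs R).2
  rw [div_mul_cancel₀ _ hN] at this
  exact (strictMono_intervalIntegral hg hpos (-n)).injective this

theorem integral_comp_monotoneTransport_mul (hg : Continuous g) (hpos : ∀ u, 0 < g u)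
    (hn : 0 < n) (hR : 0 < R) (hh : Continuous h) (h0 : ∀ t, 0 ≤ h t)
    (hs : ∀ t, t ∉ Set.Ioo (-R) R → h t = 0) {H : ℝ → ℝ} (hH : Continuous H) :
    ∫ y in (-R)..R, H (monotoneTransport g n h R y) * h y =
      (∫ t in (-R)..R, h t) / (∫ v in (-n)..n, g v) * ∫ u in (-n)..n, H u * g u := by
  have hTc := continuous_monotoneTransport hg hpos hn hR hh h0 hs
  have hm : 0 < ∫ v in (-n)..n, g v :=
    intervalIntegral.intervalIntegral_pos_of_pos (hg.intervalIntegrable _ _) hpos (by linarith)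
  by_cases hN : ∫ t in (-R)..R, h t = 0
  · have hz : ∀ y ∈ Set.Icc (-R) R, h y = 0 := by
      intro y hy
      by_contra hne
      have : 0 < ∫ t in (-R)..R, h t :=
        intervalIntegral.integral_pos (by linarith) hh.continuousOn (fun t _ => h0 t)
          ⟨y, hy, lt_of_le_of_ne (h0 y) (Ne.symm hne)⟩
      exact this.ne' hN
    rw [hN, zero_div, zero_mul]
    apply intervalIntegral.integral_zero_ae
    refine Filter.Eventually.of_forall fun t ht => ?_
    rw [Set.uIoc_of_le (by linarith)] at ht
    rw [hz t ⟨ht.1.le, ht.2⟩, mul_zero]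
  have hHg : Continuous fun u => H u * g u := hH.mul hg
  have hd : ∀ y ∈ Set.uIcc (-R) R, HasDerivAt
      (fun y => ∫ u in (-n)..(monotoneTransport g n h R y), H u * g u)
      ((∫ v in (-n)..n, g v) / (∫ t in (-R)..R, h t) *
        (H (monotoneTransport g n h R y) * h y)) y := by
    intro y _
    have h1 := (hHg.integral_hasStrictDerivAt (-n) (monotoneTransport g n h R y)).hasDerivAt
    refine (h1.comp y (hasDerivAt_monotoneTransport hg hpos hn hR hh h0 hs y)).congr_deriv ?_
    have := (hpos (monotoneTransport g n h R y)).ne'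
    field_simp
  have hF := intervalIntegral.integral_eq_sub_of_hasDerivAt hd
    ((continuous_const.mul ((hH.comp hTc).mul hh)).intervalIntegrable _ _)
  rw [intervalIntegral.integral_const_mul, monotoneTransport_left hg hpos hn hR hh h0 hs,
    monotoneTransport_right hg hpos hn hR hh h0 hs hN, intervalIntegral.integral_same,
    sub_zero] at hF
  rw [← hF]
  field_simp

end Transport

section Knothe

theorem integrableOn_uIoc_prod_uIoc {k : ℝ → ℝ → ℝ} (hk : Continuous (Function.uncurry k))
    (a b c d : ℝ) :
    IntegrableOn (Function.uncurry k) (Set.uIoc a b ×ˢ Set.uIoc c d) :=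
  (hk.continuousOn.integrableOn_compact (isCompact_uIcc.prod isCompact_uIcc)).mono_set
    (Set.prod_mono Set.uIoc_subset_uIcc Set.uIoc_subset_uIcc)

/-- The mass of `φ ^ 2` on the vertical segment `{x} × [-R, R]`. -/
noncomputable def fiberMass (φ : ℝ → ℝ → ℝ) (R x : ℝ) : ℝ :=
  ∫ y in (-R)..R, φ x y ^ 2

/-- The first component of the Knothe map from the density `φ ^ 2` on `[-R, R] ^ 2` to a multiple
of the density `γ ^ 2` on `[-n, n] ^ 2`. -/
noncomputable def knotheFst (γ : ℝ → ℝ → ℝ) (n : ℝ) (φ : ℝ → ℝ → ℝ) (R x : ℝ) : ℝ :=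
  monotoneTransport (fiberMass γ n) n (fiberMass φ R) R x

/-- The second component of the Knothe map from the density `φ ^ 2` on `[-R, R] ^ 2` to a multiple
of the density `γ ^ 2` on `[-n, n] ^ 2`. -/
noncomputable def knotheSnd (γ : ℝ → ℝ → ℝ) (n : ℝ) (φ : ℝ → ℝ → ℝ) (R x y : ℝ) : ℝ :=
  monotoneTransport (fun v => γ (knotheFst γ n φ R x) v ^ 2) n (fun y => φ x y ^ 2) R y

variable {γ φ : ℝ → ℝ → ℝ} {n R : ℝ}

theorem continuous_fiberMass (hφ : Continuous (Function.uncurry φ)) :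
    Continuous (fiberMass φ R) :=
  intervalIntegral.continuous_parametric_intervalIntegral_of_continuous'
    (f := fun x y => φ x y ^ 2) (hφ.fun_pow 2) _ _

theorem fiberMass_pos (hγ : Continuous (Function.uncurry γ)) (hpos : ∀ u v, 0 < γ u v)
    (hn : 0 < n) (u : ℝ) : 0 < fiberMass γ n u :=
  intervalIntegral.intervalIntegral_pos_of_pos
    (((hγ.uncurry_left u).pow 2).intervalIntegrable _ _)
    (fun v => pow_pos (hpos u v) 2) (by linarith)

theorem fiberMass_nonneg (hR : 0 < R) (x : ℝ) : 0 ≤ fiberMass φ R x :=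
  intervalIntegral.integral_nonneg (by linarith) fun _ _ => sq_nonneg _

theorem fiberMass_eq_zero (hs : ∀ x y, φ x y ≠ 0 → x ∈ Set.Ioo (-R) R ∧ y ∈ Set.Ioo (-R) R)
    (x : ℝ) (hx : x ∉ Set.Ioo (-R) R) : fiberMass φ R x = 0 := by
  have : ∀ y, φ x y = 0 := fun y => by
    by_contra h
    exact hx (hs x y h).1
  simp [fiberMass, this]

theorem eq_zero_of_fiberMass_eq_zero (hφ : Continuous (Function.uncurry φ)) (hR : 0 < R)
    (hs : ∀ x y, φ x y ≠ 0 → x ∈ Set.Ioo (-R) R ∧ y ∈ Set.Ioo (-R) R)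
    {x : ℝ} (hx : fiberMass φ R x = 0) (y : ℝ) : φ x y = 0 := by
  by_contra hne
  have : 0 < fiberMass φ R x :=
    intervalIntegral.integral_pos (by linarith) ((hφ.uncurry_left x).pow 2).continuousOn
      (fun t _ => sq_nonneg _)
      ⟨y, Set.Ioo_subset_Icc_self (hs x y hne).2, by positivity⟩
  exact this.ne' hx

theorem sq_eq_zero_of_notMem_Ioo
    (hs : ∀ x y, φ x y ≠ 0 → x ∈ Set.Ioo (-R) R ∧ y ∈ Set.Ioo (-R) R) (x t : ℝ)
    (ht : t ∉ Set.Ioo (-R) R) : φ x t ^ 2 = 0 := by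
  by_contra h
  exact ht (hs x t fun h' => h (by simp [h'])).2

theorem continuous_knotheFst (hγ : Continuous (Function.uncurry γ)) (hpos : ∀ u v, 0 < γ u v)
    (hn : 0 < n) (hR : 0 < R) (hφ : Continuous (Function.uncurry φ))
    (hs : ∀ x y, φ x y ≠ 0 → x ∈ Set.Ioo (-R) R ∧ y ∈ Set.Ioo (-R) R) :
    Continuous (knotheFst γ n φ R) :=
  continuous_monotoneTransport (continuous_fiberMass hγ) (fiberMass_pos hγ hpos hn) hn hR
    (continuous_fiberMass hφ) (fiberMass_nonneg hR) (fiberMass_eq_zero hs)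

theorem knotheFst_mem_Icc (hγ : Continuous (Function.uncurry γ)) (hpos : ∀ u v, 0 < γ u v)
    (hn : 0 < n) (hR : 0 < R) (hφ : Continuous (Function.uncurry φ))
    (hs : ∀ x y, φ x y ≠ 0 → x ∈ Set.Ioo (-R) R ∧ y ∈ Set.Ioo (-R) R) (x : ℝ) :
    knotheFst γ n φ R x ∈ Set.Icc (-n) n :=
  (monotoneTransport_spec (continuous_fiberMass hγ) (fiberMass_pos hγ hpos hn) hn hR
    (continuous_fiberMass hφ) (fiberMass_nonneg hR) (fiberMass_eq_zero hs) x).1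

theorem knotheSnd_spec (hγ : Continuous (Function.uncurry γ)) (hpos : ∀ u v, 0 < γ u v)
    (hn : 0 < n) (hR : 0 < R) (hφ : Continuous (Function.uncurry φ))
    (hs : ∀ x y, φ x y ≠ 0 → x ∈ Set.Ioo (-R) R ∧ y ∈ Set.Ioo (-R) R) (x y : ℝ) :
    knotheSnd γ n φ R x y ∈ Set.Icc (-n) n ∧
      ∫ v in (-n)..(knotheSnd γ n φ R x y), γ (knotheFst γ n φ R x) v ^ 2 =
        fiberMass γ n (knotheFst γ n φ R x) / fiberMass φ R x * ∫ t in (-R)..y, φ x t ^ 2 :=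
  monotoneTransport_spec ((hγ.uncurry_left (knotheFst γ n φ R x)).pow 2)
    (fun v => pow_pos (hpos _ v) 2) hn hR ((hφ.uncurry_left x).pow 2) (fun _ => sq_nonneg _)
    (sq_eq_zero_of_notMem_Ioo hs x) y

theorem measurable_knotheSnd (hγ : Continuous (Function.uncurry γ)) (hpos : ∀ u v, 0 < γ u v)
    (hn : 0 < n) (hR : 0 < R) (hφ : Continuous (Function.uncurry φ))
    (hs : ∀ x y, φ x y ≠ 0 → x ∈ Set.Ioo (-R) R ∧ y ∈ Set.Ioo (-R) R) :
    Measurable (Function.uncurry (knotheSnd γ n φ R)) := by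
  have hT := continuous_knotheFst hγ hpos hn hR hφ hs
  refine measurable_of_Iic fun c => ?_
  have : Function.uncurry (knotheSnd γ n φ R) ⁻¹' Set.Iic c = {p : ℝ × ℝ |
      fiberMass γ n (knotheFst γ n φ R p.1) / fiberMass φ R p.1 * ∫ t in (-R)..p.2, φ p.1 t ^ 2 ≤
        ∫ v in (-n)..c, γ (knotheFst γ n φ R p.1) v ^ 2} := by
    ext ⟨x, y⟩
    simp only [Set.mem_preimage, Function.uncurry_apply_pair, Set.mem_Iic, Set.mem_ofPred_eq]
    rw [← (knotheSnd_spec hγ hpos hn hR hφ hs x y).2]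
    exact ((strictMono_intervalIntegral ((hγ.uncurry_left (knotheFst γ n φ R x)).pow 2)
      (fun v => pow_pos (hpos _ v) 2) (-n)).le_iff_le).symm
  rw [this]
  apply measurableSet_le
  · refine Measurable.mul (Measurable.div ?_ ?_) ?_
    · exact ((continuous_fiberMass hγ).comp (hT.comp continuous_fst)).measurable
    · exact ((continuous_fiberMass hφ).comp continuous_fst).measurable
    · refine Continuous.measurable ?_
      refine intervalIntegral.continuous_parametric_intervalIntegral_of_continuous
        (f := fun (p : ℝ × ℝ) t => φ p.1 t ^ 2) ?_ continuous_snd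
      exact (hφ.comp ((continuous_fst.comp continuous_fst).prodMk continuous_snd)).pow 2
  · refine Continuous.measurable ?_
    refine intervalIntegral.continuous_parametric_intervalIntegral_of_continuous'
      (f := fun (p : ℝ × ℝ) v => γ (knotheFst γ n φ R p.1) v ^ 2) ?_ _ _
    exact (hγ.comp ((hT.comp (continuous_fst.comp continuous_fst)).prodMk continuous_snd)).pow 2

theorem integral_comp_knotheSnd (hγ : Continuous (Function.uncurry γ))
    (hpos : ∀ u v, 0 < γ u v)
    (hn : 0 < n) (hR : 0 < R) (hφ : Continuous (Function.uncurry φ))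
    (hs : ∀ x y, φ x y ≠ 0 → x ∈ Set.Ioo (-R) R ∧ y ∈ Set.Ioo (-R) R)
    {H : ℝ → ℝ} (hH : Continuous H) (x : ℝ) :
    ∫ y in (-R)..R, H (knotheSnd γ n φ R x y) * φ x y ^ 2 =
      fiberMass φ R x / fiberMass γ n (knotheFst γ n φ R x) *
        ∫ v in (-n)..n, H v * γ (knotheFst γ n φ R x) v ^ 2 :=
  integral_comp_monotoneTransport_mul ((hγ.uncurry_left (knotheFst γ n φ R x)).pow 2)
    (fun v => pow_pos (hpos _ v) 2) hn hR ((hφ.uncurry_left x).pow 2) (fun _ => sq_nonneg _)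
    (sq_eq_zero_of_notMem_Ioo hs x) hH

theorem integral_comp_knothe (hγ : Continuous (Function.uncurry γ)) (hpos : ∀ u v, 0 < γ u v)
    (hn : 0 < n) (hR : 0 < R) (hφ : Continuous (Function.uncurry φ))
    (hs : ∀ x y, φ x y ≠ 0 → x ∈ Set.Ioo (-R) R ∧ y ∈ Set.Ioo (-R) R)
    {K : ℝ → ℝ → ℝ} (hK : Continuous (Function.uncurry K)) :
    ∫ x in (-R)..R, ∫ y in (-R)..R,
        K (knotheFst γ n φ R x) (knotheSnd γ n φ R x y) * φ x y ^ 2 =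
      (∫ x in (-R)..R, fiberMass φ R x) / (∫ u in (-n)..n, fiberMass γ n u) *
        ∫ u in (-n)..n, ∫ v in (-n)..n, K u v * γ u v ^ 2 := by
  have hKc : Continuous fun u => ∫ v in (-n)..n, K u v * γ u v ^ 2 :=
    intervalIntegral.continuous_parametric_intervalIntegral_of_continuous'
      (f := fun u v => K u v * γ u v ^ 2) (hK.fun_mul (hγ.fun_pow 2)) _ _
  have hγp := fiberMass_pos hγ hpos hn
  have h := integral_comp_monotoneTransport_mul (continuous_fiberMass hγ) hγp hn hR
    (continuous_fiberMass hφ) (fiberMass_nonneg hR) (fiberMass_eq_zero hs)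
    (H := fun u => (∫ v in (-n)..n, K u v * γ u v ^ 2) / fiberMass γ n u)
    (hKc.div (continuous_fiberMass hγ) fun u => (hγp u).ne')
  have e : ∀ u, (∫ v in (-n)..n, K u v * γ u v ^ 2) / fiberMass γ n u * fiberMass γ n u =
      ∫ v in (-n)..n, K u v * γ u v ^ 2 := fun u => div_mul_cancel₀ _ (hγp u).ne'
  simp only [e] at h
  rw [← h]
  refine intervalIntegral.integral_congr fun x _ => ?_
  rw [integral_comp_knotheSnd hγ hpos hn hR hφ hs (hK.uncurry_left _) x]
  simp only [knotheFst]
  ring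

theorem knothe_inequality (hγ : Continuous (Function.uncurry γ)) (hpos : ∀ u v, 0 < γ u v)
    (hn : 0 < n) (hR : 0 < R) (hφ : Continuous (Function.uncurry φ)) (h0 : ∀ x y, 0 ≤ φ x y)
    (hs : ∀ x y, φ x y ≠ 0 → x ∈ Set.Ioo (-R) R ∧ y ∈ Set.Ioo (-R) R)
    {φ₁ φ₂ : ℝ → ℝ → ℝ} (hφ₁ : Continuous (Function.uncurry φ₁))
    (hφ₂ : Continuous (Function.uncurry φ₂))
    (hd₁ : ∀ x y, HasDerivAt (fun x => φ x y) (φ₁ x y) x)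
    (hd₂ : ∀ x y, HasDerivAt (fun y => φ x y) (φ₂ x y) y)
    (hN : 0 < ∫ x in (-R)..R, fiberMass φ R x) :
    √((∫ x in (-R)..R, fiberMass φ R x) / (∫ u in (-n)..n, fiberMass γ n u)) *
        ∫ u in (-n)..n, ∫ v in (-n)..n, γ u v ≤
      -(1 / 2) * ∫ x in (-R)..R, ∫ y in (-R)..R,
        (φ₁ x y * knotheFst γ n φ R x + φ₂ x y * knotheSnd γ n φ R x y) := by
  set N := ∫ x in (-R)..R, fiberMass φ R x with hNdef
  set m := ∫ u in (-n)..n, fiberMass γ n u with hmdef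
  set T := knotheFst γ n φ R with hT
  set S := knotheSnd γ n φ R with hS
  have hγp := fiberMass_pos hγ hpos hn
  have hm : 0 < m := intervalIntegral.intervalIntegral_pos_of_pos
    ((continuous_fiberMass hγ).intervalIntegrable _ _) hγp (by linarith)
  have hTc : Continuous T := continuous_knotheFst hγ hpos hn hR hφ hs
  have hTd : ∀ x, HasDerivAt T (m / N * fiberMass φ R x / fiberMass γ n (T x)) x :=
    hasDerivAt_monotoneTransport (continuous_fiberMass hγ) hγp hn hR
      (continuous_fiberMass hφ) (fiberMass_nonneg hR) (fiberMass_eq_zero hs)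
  have hSc : ∀ x, Continuous (S x) := fun x =>
    continuous_monotoneTransport ((hγ.uncurry_left (T x)).pow 2)
      (fun v => pow_pos (hpos _ v) 2) hn hR ((hφ.uncurry_left x).pow 2) (fun _ => sq_nonneg _)
      (sq_eq_zero_of_notMem_Ioo hs x)
  have hSd : ∀ x y, HasDerivAt (S x)
      (fiberMass γ n (T x) / fiberMass φ R x * φ x y ^ 2 / γ (T x) (S x y) ^ 2) y := fun x =>
    hasDerivAt_monotoneTransport ((hγ.uncurry_left (T x)).pow 2)
      (fun v => pow_pos (hpos _ v) 2) hn hR ((hφ.uncurry_left x).pow 2) (fun _ => sq_nonneg _)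
      (sq_eq_zero_of_notMem_Ioo hs x)
  set T' : ℝ → ℝ := fun x => m / N * fiberMass φ R x / fiberMass γ n (T x) with hT'
  set S' : ℝ → ℝ → ℝ := fun x y =>
    fiberMass γ n (T x) / fiberMass φ R x * φ x y ^ 2 / γ (T x) (S x y) ^ 2 with hS'
  have hT'c : Continuous T' := (continuous_const.mul (continuous_fiberMass hφ)).div
    ((continuous_fiberMass hγ).comp hTc) fun x => (hγp _).ne'
  have hγS : ∀ x, Continuous fun y => γ (T x) (S x y) := fun x =>
    (hγ.uncurry_left (T x)).comp (hSc x)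
  have hS'c : ∀ x, Continuous (S' x) := fun x =>
    (continuous_const.mul ((hφ.uncurry_left x).pow 2)).div ((hγS x).pow 2)
      fun y => (pow_pos (hpos _ _) 2).ne'
  have hbx : ∀ y, φ R y = 0 ∧ φ (-R) y = 0 := fun y =>
    ⟨by_contra fun h => lt_irrefl _ (hs _ _ h).1.2, by_contra fun h => lt_irrefl _ (hs _ _ h).1.1⟩
  have hby : ∀ x, φ x R = 0 ∧ φ x (-R) = 0 := fun x =>
    ⟨by_contra fun h => lt_irrefl _ (hs _ _ h).2.2, by_contra fun h => lt_irrefl _ (hs _ _ h).2.1⟩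
  -- the arithmetic-geometric mean inequality for the triangular Jacobian
  have hamgm : ∀ x y, √(m / N) * ((γ (T x) (S x y))⁻¹ * φ x y ^ 2) ≤
      1 / 2 * (φ x y * T' x + φ x y * S' x y) := by
    intro x y
    rcases (fiberMass_nonneg (φ := φ) hR x).eq_or_lt with hx | hx
    · simp [eq_zero_of_fiberMass_eq_zero hφ hR hs hx.symm y]
    have hT'0 : 0 ≤ T' x := by have := hγp (T x); positivity
    have hS'0 : 0 ≤ S' x y := by have := hγp (T x); positivity
    have hprod : √(m / N) * ((γ (T x) (S x y))⁻¹ * φ x y) = √(T' x) * √(S' x y) := by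
      rw [← Real.sqrt_mul hT'0]
      have : T' x * S' x y = (m / N) * ((γ (T x) (S x y))⁻¹ * φ x y) ^ 2 := by
        have := (hγp (T x)).ne'
        have := (hpos (T x) (S x y)).ne'
        simp only [hT', hS']
        field_simp
      rw [this, Real.sqrt_mul (by positivity), Real.sqrt_sq]
      have := hpos (T x) (S x y)
      have := h0 x y
      positivity
    have h2 : √(T' x) * √(S' x y) ≤ 1 / 2 * (T' x + S' x y) := by
      nlinarith [sq_nonneg (√(T' x) - √(S' x y)), Real.sq_sqrt hT'0, Real.sq_sqrt hS'0]
    calc √(m / N) * ((γ (T x) (S x y))⁻¹ * φ x y ^ 2)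
        = φ x y * (√(m / N) * ((γ (T x) (S x y))⁻¹ * φ x y)) := by ring
      _ ≤ φ x y * (1 / 2 * (T' x + S' x y)) := by
        rw [hprod]; exact mul_le_mul_of_nonneg_left h2 (h0 x y)
      _ = _ := by ring
  have hibp : ∀ x, ∫ y in (-R)..R, φ x y * S' x y = -∫ y in (-R)..R, φ₂ x y * S x y := by
    intro x
    rw [intervalIntegral.integral_mul_deriv_eq_deriv_mul (fun y _ => hd₂ x y)
      (fun y _ => hSd x y) ((hφ₂.uncurry_left x).intervalIntegrable _ _)
      ((hS'c x).intervalIntegrable _ _), (hby x).1, (hby x).2]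
    simp
  have hibp₁ : ∫ x in (-R)..R, ∫ y in (-R)..R, φ x y * T' x =
      -∫ x in (-R)..R, ∫ y in (-R)..R, φ₁ x y * T x := by
    rw [intervalIntegral_intervalIntegral_swap (F := fun x y => φ x y * T' x)
        (integrableOn_uIoc_prod_uIoc (by fun_prop) _ _ _ _),
      intervalIntegral_intervalIntegral_swap (F := fun x y => φ₁ x y * T x)
        (integrableOn_uIoc_prod_uIoc (by fun_prop) _ _ _ _), ← intervalIntegral.integral_neg]
    refine intervalIntegral.integral_congr fun y _ => ?_
    rw [intervalIntegral.integral_mul_deriv_eq_deriv_mul (fun x _ => hd₁ x y)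
      (fun x _ => hTd x) ((hφ₁.uncurry_right y).intervalIntegrable _ _)
      (hT'c.intervalIntegrable _ _), (hbx y).1, (hbx y).2]
    simp
  have hγTc : Continuous fun x => ∫ v in (-n)..n, γ (T x) v :=
    intervalIntegral.continuous_parametric_intervalIntegral_of_continuous'
      (f := fun x v => γ (T x) v)
      (hγ.comp ((hTc.comp continuous_fst).prodMk continuous_snd)) _ _
  have hinv : Continuous (Function.uncurry fun u v => (γ u v)⁻¹) :=
    hγ.inv₀ fun p => (hpos _ _).ne'
  have hslice : ∀ x, ∫ y in (-R)..R, (γ (T x) (S x y))⁻¹ * φ x y ^ 2 =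
      fiberMass φ R x / fiberMass γ n (T x) * ∫ v in (-n)..n, γ (T x) v := by
    intro x
    rw [integral_comp_knotheSnd hγ hpos hn hR hφ hs (hinv.uncurry_left (T x)) x]
    congr 1
    refine intervalIntegral.integral_congr fun v _ => ?_
    have := (hpos (T x) v).ne'
    field_simp
    rfl
  have htot : ∫ x in (-R)..R, ∫ y in (-R)..R, (γ (T x) (S x y))⁻¹ * φ x y ^ 2 =
      N / m * ∫ u in (-n)..n, ∫ v in (-n)..n, γ u v := by
    rw [integral_comp_knothe hγ hpos hn hR hφ hs hinv]
    congr 1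
    refine intervalIntegral.integral_congr fun u _ =>
      intervalIntegral.integral_congr fun v _ => ?_
    have := (hpos u v).ne'
    field_simp
  have hint₂ : IntervalIntegrable (fun x => ∫ y in (-R)..R, φ₂ x y * S x y) volume (-R) R := by
    have hi : IntegrableOn (Function.uncurry fun x y => φ₂ x y * S x y)
        (Set.uIoc (-R) R ×ˢ Set.uIoc (-R) R) :=
      (integrableOn_uIoc_prod_uIoc hφ₂ _ _ _ _).mul_bdd (c := n)
        (measurable_knotheSnd hγ hpos hn hR hφ hs).aestronglyMeasurable
        (Filter.Eventually.of_forall fun p =>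
          abs_le.2 (knotheSnd_spec hγ hpos hn hR hφ hs p.1 p.2).1)
    rw [IntegrableOn, Measure.volume_eq_prod, ← Measure.prod_restrict] at hi
    rw [intervalIntegrable_iff]
    have := hi.integral_prod_left
    rw [Set.uIoc_of_le (by linarith : -R ≤ R)] at this ⊢
    refine this.congr (Filter.Eventually.of_forall fun x => ?_)
    simp only [Function.uncurry_apply_pair]
    rw [intervalIntegral.integral_of_le (by linarith)]
  have hc₁ : ∀ g : ℝ → ℝ, Continuous g → ∀ ψ : ℝ → ℝ → ℝ, Continuous (Function.uncurry ψ) →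
      Continuous fun x => ∫ y in (-R)..R, ψ x y * g x := fun g hg ψ hψ =>
    intervalIntegral.continuous_parametric_intervalIntegral_of_continuous'
      (f := fun x y => ψ x y * g x) (hψ.mul (hg.comp continuous_fst)) _ _
  have hmain : ∫ x in (-R)..R, √(m / N) * ∫ y in (-R)..R, (γ (T x) (S x y))⁻¹ * φ x y ^ 2 ≤
      ∫ x in (-R)..R, (1 / 2 * (∫ y in (-R)..R, φ x y * T' x) -
        1 / 2 * ∫ y in (-R)..R, φ₂ x y * S x y) := by
    refine intervalIntegral.integral_mono_on (by linarith) ?_ ?_ fun x _ => ?_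
    · simp only [hslice]
      exact (continuous_const.mul (((continuous_fiberMass hφ).div
        ((continuous_fiberMass hγ).comp hTc) fun x => (hγp _).ne').mul hγTc)).intervalIntegrable
        _ _
    · exact (((hc₁ T' hT'c φ hφ).intervalIntegrable _ _).const_mul _).sub (hint₂.const_mul _)
    · have hf := hφ.uncurry_left x
      rw [sub_eq_add_neg, ← mul_neg, ← hibp x, ← mul_add, ← intervalIntegral.integral_const_mul,
        ← intervalIntegral.integral_add, ← intervalIntegral.integral_const_mul]
      · refine intervalIntegral.integral_mono_on (by linarith) ?_ ?_ fun y _ => hamgm x y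
        · exact (continuous_const.mul (((hγS x).inv₀ fun y => (hpos _ _).ne').mul
            (hf.pow 2))).intervalIntegrable _ _
        · exact (continuous_const.mul ((hf.mul continuous_const).add
            (hf.mul (hS'c x)))).intervalIntegrable _ _
      · exact (hf.mul continuous_const).intervalIntegrable _ _
      · exact (hf.mul (hS'c x)).intervalIntegrable _ _
  rw [intervalIntegral.integral_const_mul, htot, intervalIntegral.integral_sub
    (((hc₁ T' hT'c φ hφ).intervalIntegrable _ _).const_mul _) (hint₂.const_mul _),
    intervalIntegral.integral_const_mul, intervalIntegral.integral_const_mul, hibp₁] at hmain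
  have hsplit : ∫ x in (-R)..R, ∫ y in (-R)..R, (φ₁ x y * T x + φ₂ x y * S x y) =
      (∫ x in (-R)..R, ∫ y in (-R)..R, φ₁ x y * T x) +
        ∫ x in (-R)..R, ∫ y in (-R)..R, φ₂ x y * S x y := by
    rw [← intervalIntegral.integral_add ((hc₁ T hTc φ₁ hφ₁).intervalIntegrable _ _) hint₂]
    refine intervalIntegral.integral_congr fun x _ => ?_
    exact intervalIntegral.integral_add
      (((hφ₁.uncurry_left x).mul continuous_const).intervalIntegrable _ _)
      (((hφ₂.uncurry_left x).mul (hSc x)).intervalIntegrable _ _)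
  have hsq : √(N / m) = √(m / N) * (N / m) := by
    rw [Real.sqrt_div hN.le, Real.sqrt_div hm.le]
    have h1 := Real.sq_sqrt hN.le
    have h2 := Real.sq_sqrt hm.le
    have h3 := Real.sqrt_pos.2 hN
    have h4 := Real.sqrt_pos.2 hm
    rw [div_mul_div_comm, div_eq_div_iff h4.ne' (by positivity)]
    nlinarith
  rw [hsplit, hsq]
  linarith

end Knothe

section ComplexPlane

theorem intervalIntegral_intervalIntegral_eq_setIntegral_reProdIm {n : ℝ} (hn : 0 < n)
    {k : ℂ → ℝ} (hk : IntegrableOn k (Set.Ioc (-n) n ×ℂ Set.Ioc (-n) n)) :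
    ∫ x in (-n)..n, ∫ y in (-n)..n, k ⟨x, y⟩ =
      ∫ z in Set.Ioc (-n) n ×ℂ Set.Ioc (-n) n, k z := by
  have hmp := Complex.volume_preserving_equiv_real_prod.symm
  have hpre : (Complex.measurableEquivRealProd.symm ⁻¹' (Set.Ioc (-n) n ×ℂ Set.Ioc (-n) n)) =
      Set.Ioc (-n) n ×ˢ Set.Ioc (-n) n := by
    ext ⟨x, y⟩
    simp [Complex.mem_reProdIm, Complex.measurableEquivRealProd]
  have hemb := Complex.measurableEquivRealProd.symm.measurableEmbedding
  rw [← hmp.setIntegral_preimage_emb hemb, hpre]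
  rw [← hmp.integrableOn_comp_preimage hemb, hpre] at hk
  rw [Measure.volume_eq_prod] at hk ⊢
  rw [setIntegral_prod (fun p => k (Complex.measurableEquivRealProd.symm p)) hk,
    intervalIntegral.integral_of_le (by linarith)]
  refine setIntegral_congr_fun measurableSet_Ioc fun x _ => ?_
  rw [intervalIntegral.integral_of_le (by linarith)]
  rfl

theorem integrableOn_reProdIm {n : ℝ} {k : ℂ → ℝ} (hk : Continuous k) :
    IntegrableOn k (Set.Ioc (-n) n ×ℂ Set.Ioc (-n) n) :=
  (hk.continuousOn.integrableOn_compact (isCompact_Icc.reProdIm isCompact_Icc)).mono_set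
    (Complex.reProdIm_subset_iff.2
      (Set.prod_mono Set.Ioc_subset_Icc_self Set.Ioc_subset_Icc_self))

/-- The Knothe map on the complex plane, transporting `φ ^ 2` to a multiple of `γ ^ 2` restricted
to the square of half-side `n`, when `φ` is supported in the ball of radius `R`. -/
noncomputable def knotheMap (γ : ℂ → ℝ) (n : ℝ) (φ : ℂ → ℝ) (R : ℝ) (z : ℂ) : ℂ :=
  ⟨knotheFst (fun x y => γ ⟨x, y⟩) n (fun x y => φ ⟨x, y⟩) R z.re,
    knotheSnd (fun x y => γ ⟨x, y⟩) n (fun x y => φ ⟨x, y⟩) R z.re z.im⟩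

variable {φ γ : ℂ → ℝ} {n R : ℝ}

theorem continuous_complex_mk : Continuous fun p : ℝ × ℝ => (⟨p.1, p.2⟩ : ℂ) :=
  Complex.equivRealProdCLM.symm.continuous

theorem continuous_uncurry_complex_mk (hφ : Continuous φ) :
    Continuous (Function.uncurry fun x y => φ ⟨x, y⟩) :=
  hφ.comp continuous_complex_mk

theorem mem_Ioo_of_tsupport_subset (hs : tsupport φ ⊆ Metric.ball 0 R) (x y : ℝ)
    (h : φ ⟨x, y⟩ ≠ 0) : x ∈ Set.Ioo (-R) R ∧ y ∈ Set.Ioo (-R) R := by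
  have hz : (⟨x, y⟩ : ℂ) ∈ Metric.ball (0 : ℂ) R := hs (subset_tsupport φ h)
  rw [mem_ball_zero_iff] at hz
  exact ⟨abs_lt.1 ((Complex.abs_re_le_norm ⟨x, y⟩).trans_lt hz),
    abs_lt.1 ((Complex.abs_im_le_norm ⟨x, y⟩).trans_lt hz)⟩

theorem notMem_tsupport_of_notMem_reProdIm (hs : tsupport φ ⊆ Metric.ball 0 R) {z : ℂ}
    (hz : z ∉ Set.Ioc (-R) R ×ℂ Set.Ioc (-R) R) : z ∉ tsupport φ := by
  intro hz'
  have := hs hz'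
  rw [mem_ball_zero_iff] at this
  exact hz ⟨Set.Ioo_subset_Ioc_self (abs_lt.1 ((Complex.abs_re_le_norm z).trans_lt this)),
    Set.Ioo_subset_Ioc_self (abs_lt.1 ((Complex.abs_im_le_norm z).trans_lt this))⟩

theorem intervalIntegral_intervalIntegral_eq_integral (hR : 0 < R)
    (hs : tsupport φ ⊆ Metric.ball 0 R) {k : ℂ → ℝ} (hk : Integrable k)
    (hkφ : ∀ z, z ∉ tsupport φ → k z = 0) :
    ∫ x in (-R)..R, ∫ y in (-R)..R, k ⟨x, y⟩ = ∫ z, k z := by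
  rw [intervalIntegral_intervalIntegral_eq_setIntegral_reProdIm hR hk.integrableOn]
  exact setIntegral_eq_integral_of_forall_compl_eq_zero fun z hz =>
    hkφ z (notMem_tsupport_of_notMem_reProdIm hs hz)

theorem integrable_sq_of_tsupport_subset (hφ : Continuous φ) (hs : tsupport φ ⊆ Metric.ball 0 R) :
    Integrable fun z => φ z ^ 2 := by
  have hc : HasCompactSupport φ := Metric.isCompact_of_isClosed_isBounded (isClosed_tsupport φ)
    (Metric.isBounded_ball.subset hs)
  exact (hφ.fun_pow 2).integrable_of_hasCompactSupport
    (hc.comp_left (g := fun t : ℝ => t ^ 2) (by simp))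

theorem integral_fiberMass_eq_integral (hφ : Continuous φ) (hR : 0 < R)
    (hs : tsupport φ ⊆ Metric.ball 0 R) :
    ∫ x in (-R)..R, fiberMass (fun x y => φ ⟨x, y⟩) R x = ∫ z, φ z ^ 2 :=
  intervalIntegral_intervalIntegral_eq_integral hR hs (k := fun z => φ z ^ 2)
    (integrable_sq_of_tsupport_subset hφ hs)
    fun z hz => by simp [image_eq_zero_of_notMem_tsupport hz]

theorem integral_fiberMass_eq_setIntegral (hγ : Continuous γ) (hn : 0 < n) :
    ∫ x in (-n)..n, fiberMass (fun x y => γ ⟨x, y⟩) n x =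
      ∫ z in Set.Ioc (-n) n ×ℂ Set.Ioc (-n) n, γ z ^ 2 :=
  intervalIntegral_intervalIntegral_eq_setIntegral_reProdIm hn (k := fun z => γ z ^ 2)
    (integrableOn_reProdIm (hγ.fun_pow 2))

theorem measurable_knotheMap (hγ : Continuous γ) (hpos : ∀ z, 0 < γ z) (hn : 0 < n)
    (hφ : Continuous φ) (hR : 0 < R) (hs : tsupport φ ⊆ Metric.ball 0 R) :
    Measurable (knotheMap γ n φ R) := by
  have hF := (continuous_knotheFst (continuous_uncurry_complex_mk hγ) (fun _ _ => hpos _) hn hR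
    (continuous_uncurry_complex_mk hφ) (mem_Ioo_of_tsupport_subset hs)).measurable
  have hS := measurable_knotheSnd (continuous_uncurry_complex_mk hγ) (fun _ _ => hpos _) hn hR
    (continuous_uncurry_complex_mk hφ) (mem_Ioo_of_tsupport_subset hs)
  exact continuous_complex_mk.measurable.comp ((hF.comp Complex.measurable_re).prodMk
    (hS.comp (Complex.measurable_re.prodMk Complex.measurable_im)))

theorem norm_knotheMap_le (hγ : Continuous γ) (hpos : ∀ z, 0 < γ z) (hn : 0 < n)
    (hφ : Continuous φ) (hR : 0 < R) (hs : tsupport φ ⊆ Metric.ball 0 R) (z : ℂ) :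
    ‖knotheMap γ n φ R z‖ ≤ 2 * n := by
  have h1 := abs_le.2 (knotheFst_mem_Icc (continuous_uncurry_complex_mk hγ) (fun _ _ => hpos _) hn
    hR (continuous_uncurry_complex_mk hφ) (mem_Ioo_of_tsupport_subset hs) z.re)
  have h2 := abs_le.2 (knotheSnd_spec (continuous_uncurry_complex_mk hγ) (fun _ _ => hpos _) hn
    hR (continuous_uncurry_complex_mk hφ) (mem_Ioo_of_tsupport_subset hs) z.re z.im).1
  have h := Complex.norm_le_abs_re_add_abs_im (knotheMap γ n φ R z)
  simp only [knotheMap] at h ⊢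
  linarith

theorem integral_comp_knotheMap_mul (hγ : Continuous γ) (hpos : ∀ z, 0 < γ z) (hn : 0 < n)
    (hφ : Continuous φ) (hR : 0 < R) (hs : tsupport φ ⊆ Metric.ball 0 R)
    {K : ℂ → ℝ} (hK : Continuous K) :
    ∫ z, K (knotheMap γ n φ R z) * φ z ^ 2 =
      (∫ z, φ z ^ 2) / (∫ z in Set.Ioc (-n) n ×ℂ Set.Ioc (-n) n, γ z ^ 2) *
        ∫ z in Set.Ioc (-n) n ×ℂ Set.Ioc (-n) n, K z * γ z ^ 2 := by
  have h := integral_comp_knothe (continuous_uncurry_complex_mk hγ) (fun _ _ => hpos _) hn hR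
    (continuous_uncurry_complex_mk hφ) (mem_Ioo_of_tsupport_subset hs)
    (K := fun u v => K ⟨u, v⟩) (continuous_uncurry_complex_mk hK)
  have h1 := intervalIntegral_intervalIntegral_eq_setIntegral_reProdIm hn
    (k := fun z => K z * γ z ^ 2) (integrableOn_reProdIm (hK.fun_mul (hγ.fun_pow 2)))
  obtain ⟨C, hC⟩ := (isCompact_closedBall (0 : ℂ) (2 * n)).exists_bound_of_continuousOn
    hK.continuousOn
  have hi : Integrable fun z => K (knotheMap γ n φ R z) * φ z ^ 2 := by
    refine (integrable_sq_of_tsupport_subset hφ hs).bdd_mul (c := C)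
      (hK.measurable.comp (measurable_knotheMap hγ hpos hn hφ hR hs)).aestronglyMeasurable
      (Filter.Eventually.of_forall fun z => hC _ ?_)
    simpa using norm_knotheMap_le hγ hpos hn hφ hR hs z
  have h2 := intervalIntegral_intervalIntegral_eq_integral hR hs hi
    fun z hz => by simp [image_eq_zero_of_notMem_tsupport hz]
  rw [← h2, ← h1, ← integral_fiberMass_eq_integral hφ hR hs,
    ← integral_fiberMass_eq_setIntegral hγ hn]
  exact h

theorem hasDerivAt_comp_complex_mk_left (hφ : ContDiff ℝ 1 φ) (x y : ℝ) :
    HasDerivAt (fun x => φ ⟨x, y⟩) (fderiv ℝ φ ⟨x, y⟩ 1) x := by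
  have hl : HasDerivAt (fun x : ℝ => (⟨x, y⟩ : ℂ)) 1 x := by
    have : (fun x : ℝ => (⟨x, y⟩ : ℂ)) = fun x : ℝ => (x : ℂ) + (y : ℂ) * Complex.I := by
      funext t; apply Complex.ext <;> simp
    rw [this]
    exact (Complex.ofRealCLM.hasDerivAt (x := x)).add_const _
  exact (hφ.differentiable one_ne_zero _).hasFDerivAt.comp_hasDerivAt x hl

theorem hasDerivAt_comp_complex_mk_right (hφ : ContDiff ℝ 1 φ) (x y : ℝ) :
    HasDerivAt (fun y => φ ⟨x, y⟩) (fderiv ℝ φ ⟨x, y⟩ Complex.I) y := by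
  have hl : HasDerivAt (fun y : ℝ => (⟨x, y⟩ : ℂ)) Complex.I y := by
    have : (fun y : ℝ => (⟨x, y⟩ : ℂ)) = fun y : ℝ => (x : ℂ) + (y : ℂ) * Complex.I := by
      funext t; apply Complex.ext <;> simp
    rw [this]
    simpa using ((Complex.ofRealCLM.hasDerivAt (x := y)).mul_const Complex.I).const_add (x : ℂ)
  exact (hφ.differentiable one_ne_zero _).hasFDerivAt.comp_hasDerivAt y hl

theorem knotheMap_inequality (hγ : Continuous γ) (hpos : ∀ z, 0 < γ z) (hn : 0 < n)
    (hφ : ContDiff ℝ 1 φ) (h0 : ∀ z, 0 ≤ φ z) (hR : 0 < R)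
    (hs : tsupport φ ⊆ Metric.ball 0 R) (hN : 0 < ∫ z, φ z ^ 2) :
    √((∫ z, φ z ^ 2) / (∫ z in Set.Ioc (-n) n ×ℂ Set.Ioc (-n) n, γ z ^ 2)) *
        ∫ z in Set.Ioc (-n) n ×ℂ Set.Ioc (-n) n, γ z ≤
      -(1 / 2) * ∫ z, fderiv ℝ φ z (knotheMap γ n φ R z) := by
  have hφc := hφ.continuous
  have hDc : Continuous (fderiv ℝ φ) := hφ.continuous_fderiv one_ne_zero
  have hc : HasCompactSupport φ := Metric.isCompact_of_isClosed_isBounded (isClosed_tsupport φ)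
    (Metric.isBounded_ball.subset hs)
  have h := knothe_inequality (continuous_uncurry_complex_mk hγ) (fun _ _ => hpos _) hn hR
    (continuous_uncurry_complex_mk hφc) (fun _ _ => h0 _) (mem_Ioo_of_tsupport_subset hs)
    (φ₁ := fun x y => fderiv ℝ φ ⟨x, y⟩ 1) (φ₂ := fun x y => fderiv ℝ φ ⟨x, y⟩ Complex.I)
    ((hDc.comp continuous_complex_mk).clm_apply continuous_const)
    ((hDc.comp continuous_complex_mk).clm_apply continuous_const)
    (hasDerivAt_comp_complex_mk_left hφ) (hasDerivAt_comp_complex_mk_right hφ)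
    (by rwa [integral_fiberMass_eq_integral hφc hR hs])
  rw [integral_fiberMass_eq_integral hφc hR hs, integral_fiberMass_eq_setIntegral hγ hn] at h
  have h1 := intervalIntegral_intervalIntegral_eq_setIntegral_reProdIm hn
    (integrableOn_reProdIm (n := n) hγ)
  have hi : Integrable fun z => fderiv ℝ φ z (knotheMap γ n φ R z) := by
    refine Integrable.mono' (g := fun z => ‖fderiv ℝ φ z‖ * (2 * n)) ?_ ?_
      (Filter.Eventually.of_forall fun z => ?_)
    · exact (hDc.norm.integrable_of_hasCompactSupport (hc.fderiv (𝕜 := ℝ)).norm).mul_const _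
    · exact (isBoundedBilinearMap_apply.continuous.measurable.comp (hDc.measurable.prodMk
        (measurable_knotheMap hγ hpos hn hφc hR hs))).aestronglyMeasurable
    · exact ((fderiv ℝ φ z).le_opNorm _).trans (mul_le_mul_of_nonneg_left
        (norm_knotheMap_le hγ hpos hn hφc hR hs z) (norm_nonneg _))
  have h2 := intervalIntegral_intervalIntegral_eq_integral hR hs hi fun z hz => by
    have : fderiv ℝ φ z = 0 := by
      by_contra hne
      exact hz (support_fderiv_subset ℝ hne)
    simp [this]
  rw [← h1, ← h2]
  refine h.trans_eq ?_
  congr 1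
  refine intervalIntegral.integral_congr fun x _ =>
    intervalIntegral.integral_congr fun y _ => ?_
  have : knotheMap γ n φ R ⟨x, y⟩ =
      knotheFst (fun x y => γ ⟨x, y⟩) n (fun x y => φ ⟨x, y⟩) R x • (1 : ℂ) +
        knotheSnd (fun x y => γ ⟨x, y⟩) n (fun x y => φ ⟨x, y⟩) R x y • Complex.I := by
    apply Complex.ext <;> simp [knotheMap]
  simp only [this, map_add, map_smul, smul_eq_mul]
  ring

end ComplexPlane

section RadialIntegrals

theorem integral_one_add_norm_rpow {a k : ℝ} (ha : 1 ≤ a) (hk : 2 / a < k) :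
    Integrable (fun z : ℂ => (1 + ‖z‖ ^ a) ^ (-k)) ∧
      ∫ z : ℂ, (1 + ‖z‖ ^ a) ^ (-k) = π * Gamma (2 / a + 1) * Gamma (k - 2 / a) / Gamma k := by
  have ha0 : 0 < a := by linarith
  have h2a : 0 < 2 / a := by positivity
  have hk0 : 0 < k := h2a.trans hk
  have hΓ := Gamma_pos_of_pos hk0
  have hy : ∀ z : ℂ, 0 < 1 + ‖z‖ ^ a := fun z => by positivity
  have hm : Measurable fun z : ℂ => (1 + ‖z‖ ^ a) ^ (-k) := by fun_prop
  have key : ∫⁻ z : ℂ, ENNReal.ofReal (Gamma k * (1 + ‖z‖ ^ a) ^ (-k)) =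
      ENNReal.ofReal (π * Gamma (2 / a + 1) * Gamma (k - 2 / a)) := by
    have e1 : ∀ z : ℂ, ENNReal.ofReal (Gamma k * (1 + ‖z‖ ^ a) ^ (-k)) =
        ∫⁻ t in Set.Ioi 0, ENNReal.ofReal (t ^ (k - 1) * exp (-((1 + ‖z‖ ^ a) * t))) := by
      intro z
      have h := integral_rpow_mul_exp_neg_mul_Ioi hk0 (hy z)
      have hval : (1 / (1 + ‖z‖ ^ a)) ^ k * Gamma k = Gamma k * (1 + ‖z‖ ^ a) ^ (-k) := by
        rw [rpow_neg (hy z).le, one_div, inv_rpow (hy z).le, mul_comm]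
      rw [← hval, ← h, ofReal_integral_eq_lintegral_ofReal]
      · refine not_imp_comm.1 integral_undef ?_
        rw [h, hval]
        exact (mul_pos hΓ (rpow_pos_of_pos (hy z) _)).ne'
      · filter_upwards [ae_restrict_mem measurableSet_Ioi] with t ht
        have : 0 < t := ht
        simp only [Pi.zero_apply]
        positivity
    have e2 : ∀ t ∈ Set.Ioi (0 : ℝ),
        ∫⁻ z : ℂ, ENNReal.ofReal (t ^ (k - 1) * exp (-((1 + ‖z‖ ^ a) * t))) =
          ENNReal.ofReal (π * Gamma (2 / a + 1) * (t ^ (k - 2 / a - 1) * exp (-(1 * t)))) := by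
      intro t ht
      have ht : 0 < t := ht
      have h := Complex.integral_exp_neg_mul_rpow ha ht
      have hfun : ∀ z : ℂ, t ^ (k - 1) * exp (-((1 + ‖z‖ ^ a) * t)) =
          t ^ (k - 1) * exp (-t) * exp (-t * ‖z‖ ^ a) := by
        intro z
        rw [mul_assoc, ← exp_add]
        ring_nf
      have hΓ2 : 0 < Gamma (2 / a + 1) := Gamma_pos_of_pos (by positivity)
      have hi : Integrable fun z : ℂ => exp (-t * ‖z‖ ^ a) := by
        refine not_imp_comm.1 integral_undef ?_
        rw [h]
        positivity
      simp_rw [hfun]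
      rw [← ofReal_integral_eq_lintegral_ofReal (hi.const_mul _)
        (Filter.Eventually.of_forall fun z => by simp only [Pi.zero_apply]; positivity),
        integral_const_mul, h]
      congr 1
      have : t ^ (k - 2 / a - 1) = t ^ (k - 1) * t ^ (-2 / a) := by
        rw [← rpow_add ht]; ring_nf
      rw [this, one_mul]
      ring
    simp_rw [e1]
    rw [lintegral_lintegral_swap (by fun_prop), setLIntegral_congr_fun measurableSet_Ioi e2]
    have h := integral_rpow_mul_exp_neg_mul_Ioi (sub_pos.2 hk) one_pos
    have hΓ2 : 0 < Gamma (2 / a + 1) := Gamma_pos_of_pos (by positivity)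
    have hΓ3 := Gamma_pos_of_pos (sub_pos.2 hk)
    rw [← ofReal_integral_eq_lintegral_ofReal, integral_const_mul, h]
    · simp
    · refine Integrable.const_mul (not_imp_comm.1 integral_undef ?_) _
      rw [h]
      simpa using hΓ3.ne'
    · filter_upwards [ae_restrict_mem measurableSet_Ioi] with t ht
      have : 0 < t := ht
      simp only [Pi.zero_apply]
      positivity
  have hnn : 0 ≤ᵐ[volume] fun z : ℂ => Gamma k * (1 + ‖z‖ ^ a) ^ (-k) :=
    Filter.Eventually.of_forall fun z => (mul_pos hΓ (rpow_pos_of_pos (hy z) _)).le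
  have hi : Integrable fun z : ℂ => Gamma k * (1 + ‖z‖ ^ a) ^ (-k) := by
    refine ⟨(hm.const_mul _).aestronglyMeasurable, ?_⟩
    rw [hasFiniteIntegral_iff_ofReal hnn, key]
    exact ENNReal.ofReal_lt_top
  refine ⟨(integrable_const_mul_iff (isUnit_iff_ne_zero.2 hΓ.ne') _).1 hi, ?_⟩
  have h := integral_eq_lintegral_of_nonneg_ae hnn hi.aestronglyMeasurable
  have hΓ2 : 0 < Gamma (2 / a + 1) := Gamma_pos_of_pos (by positivity)
  have hΓ3 := Gamma_pos_of_pos (sub_pos.2 hk)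
  rw [key, ENNReal.toReal_ofReal (by positivity), integral_const_mul] at h
  rw [eq_div_iff hΓ.ne', ← h, mul_comm]

theorem integral_norm_rpow_mul_one_add_norm_rpow {a : ℝ} (ha : 2 < a) :
    Integrable (fun z : ℂ => ‖z‖ ^ a * ((1 + ‖z‖ ^ a)⁻¹) ^ 2) ∧
    Integrable (fun z : ℂ => ((1 + ‖z‖ ^ a)⁻¹) ^ 2) ∧
    Integrable (fun z : ℂ => (1 + ‖z‖ ^ a)⁻¹) ∧
    ∫ z : ℂ, ((1 + ‖z‖ ^ a)⁻¹) ^ 2 = π * (Gamma (2 / a + 1) * Gamma (2 - 2 / a)) ∧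
    (1 - 2 / a) * ∫ z : ℂ, (1 + ‖z‖ ^ a)⁻¹ = ∫ z : ℂ, ((1 + ‖z‖ ^ a)⁻¹) ^ 2 ∧
    ∫ z : ℂ, ‖z‖ ^ a * ((1 + ‖z‖ ^ a)⁻¹) ^ 2 = 2 / a * ∫ z : ℂ, (1 + ‖z‖ ^ a)⁻¹ := by
  have ha0 : 0 < a := by linarith
  have h2a : 2 / a < 1 := by rw [div_lt_one ha0]; exact ha
  have hy : ∀ z : ℂ, 0 < 1 + ‖z‖ ^ a := fun z => by positivity
  obtain ⟨i1, h1⟩ := integral_one_add_norm_rpow (a := a) (k := 1) (by linarith) h2a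
  obtain ⟨i2, h2⟩ := integral_one_add_norm_rpow (a := a) (k := 2) (by linarith) (by linarith)
  have e1 : ∀ z : ℂ, (1 + ‖z‖ ^ a) ^ (-1 : ℝ) = (1 + ‖z‖ ^ a)⁻¹ := fun z => rpow_neg_one _
  have e2 : ∀ z : ℂ, (1 + ‖z‖ ^ a) ^ (-2 : ℝ) = ((1 + ‖z‖ ^ a)⁻¹) ^ 2 := fun z => by
    rw [rpow_neg (hy z).le, inv_pow]; norm_cast
  simp only [e1, e2] at i1 i2 h1 h2
  have e3 : ∀ z : ℂ, ‖z‖ ^ a * ((1 + ‖z‖ ^ a)⁻¹) ^ 2 =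
      (1 + ‖z‖ ^ a)⁻¹ - ((1 + ‖z‖ ^ a)⁻¹) ^ 2 := fun z => by
    have := (hy z).ne'
    field_simp
    ring
  have hΓ : Gamma (2 - 2 / a) = (1 - 2 / a) * Gamma (1 - 2 / a) := by
    rw [← Gamma_add_one (by linarith)]; ring_nf
  have hm : (1 - 2 / a) * ∫ z : ℂ, (1 + ‖z‖ ^ a)⁻¹ = ∫ z : ℂ, ((1 + ‖z‖ ^ a)⁻¹) ^ 2 := by
    rw [h1, h2, hΓ, Gamma_one, Gamma_two]; ring
  simp only [e3]
  refine ⟨i1.sub i2, i2, i1, ?_, hm, ?_⟩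
  · rw [h2, Gamma_two]; ring
  · rw [integral_sub i1 i2, ← hm]; ring

end RadialIntegrals

section SobolevInequality

theorem norm_fderiv_abs_rpow_le {f : ℂ → ℝ} (hf : ContDiff ℝ 1 f) {s : ℝ} (hs : 1 < s) (z : ℂ) :
    ‖fderiv ℝ (fun z => |f z| ^ s) z‖ ≤ s * |f z| ^ (s - 1) * ‖fderiv ℝ f z‖ := by
  have hd := (hasDerivAt_abs_rpow (f z) hs).comp_hasFDerivAt z
    (hf.differentiable one_ne_zero z).hasFDerivAt
  have he : fderiv ℝ (fun z => |f z| ^ s) z = (s * |f z| ^ (s - 2) * f z) • fderiv ℝ f z :=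
    hd.fderiv
  rw [he, norm_smul]
  refine mul_le_mul_of_nonneg_right ?_ (norm_nonneg _)
  rw [norm_eq_abs, abs_mul, abs_of_nonneg (by positivity)]
  rcases eq_or_ne (f z) 0 with h | h
  · rw [h, abs_zero, mul_zero]
    positivity
  · rw [mul_assoc]
    nth_rw 2 [← rpow_one |f z|]
    rw [← rpow_add (abs_pos.2 h), show s - 2 + 1 = s - 1 by ring]

theorem rpow_mul_setIntegral_le_of_transport {f : ℂ → ℝ} (hf : ContDiff ℝ 1 f)
    (hc : HasCompactSupport f) {p a q : ℝ} (hpa : p.HolderConjugate a) (hq : 2 < q)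
    (hqa : 1 / q + 1 / a = 1 / 2) (hN : 0 < ∫ z, |f z| ^ q) {γ : ℂ → ℝ} (hγ : Continuous γ)
    (hpos : ∀ z, 0 < γ z) (hγ2 : Integrable fun z => γ z ^ 2)
    (hγa : Integrable fun z => ‖z‖ ^ a * γ z ^ 2) {n : ℝ} (hn : 0 < n) :
    ((∫ z, |f z| ^ q) / ∫ z, γ z ^ 2) ^ (1 / q) *
        ∫ z in Set.Ioc (-n) n ×ℂ Set.Ioc (-n) n, γ z ≤
      q / 4 * (∫ z, ‖fderiv ℝ f z‖ ^ p) ^ (1 / p) * (∫ z, ‖z‖ ^ a * γ z ^ 2) ^ (1 / a) := by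
  have hp0 := hpa.pos
  have ha0 := hpa.symm.pos
  have hq0 : 0 < q := by linarith
  set s := q / 2 with hs_def
  have hs : 1 < s := by rw [hs_def]; linarith
  have hsa : (s - 1) * a = q := by
    field_simp at hqa
    rw [hs_def]; linarith
  set φ : ℂ → ℝ := fun z => |f z| ^ s with hφ_def
  have hφ : ContDiff ℝ 1 φ := (contDiff_norm_rpow hs).comp hf
  have hφ2 : ∀ z, φ z ^ 2 = |f z| ^ q := fun z => by
    rw [hφ_def]
    simp only
    rw [← rpow_natCast, ← rpow_mul (abs_nonneg _), hs_def]
    norm_num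
  have hφc : HasCompactSupport φ :=
    hc.comp_left (g := fun t : ℝ => |t| ^ s) (by simp [zero_rpow (by linarith : s ≠ 0)])
  obtain ⟨R, hR, hsub⟩ := hφc.isBounded.subset_ball_lt 0 0
  set B := Set.Ioc (-n) n ×ℂ Set.Ioc (-n) n with hB
  set N := ∫ z, |f z| ^ q with hN_def
  have hNφ : ∫ z, φ z ^ 2 = N := by simp only [hφ2, hN_def]
  set m := ∫ z, γ z ^ 2 with hm_def
  set mB := ∫ z in B, γ z ^ 2 with hmB_def
  have hmle : mB ≤ m := setIntegral_le_integral hγ2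
    (Filter.Eventually.of_forall fun z => sq_nonneg _)
  have hmB : 0 < mB := by
    rw [hmB_def, hB, ← integral_fiberMass_eq_setIntegral hγ hn]
    exact intervalIntegral.intervalIntegral_pos_of_pos
      ((continuous_fiberMass (continuous_uncurry_complex_mk hγ)).intervalIntegrable _ _)
      (fiberMass_pos (continuous_uncurry_complex_mk hγ) (fun _ _ => hpos _) hn) (by linarith)
  set T := knotheMap γ n φ R with hT
  have hTm : Measurable T := measurable_knotheMap hγ hpos hn hφ.continuous hR hsub
  have hTb : ∀ z, ‖T z‖ ≤ 2 * n := norm_knotheMap_le hγ hpos hn hφ.continuous hR hsub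
  have hpush : ∫ z, ‖T z‖ ^ a * φ z ^ 2 = N / mB * ∫ z in B, ‖z‖ ^ a * γ z ^ 2 := by
    rw [← hNφ]
    exact integral_comp_knotheMap_mul hγ hpos hn hφ.continuous hR hsub
      (K := fun z => ‖z‖ ^ a) (continuous_norm.rpow_const fun _ => Or.inr ha0.le)
  have hmain := knotheMap_inequality hγ hpos hn hφ (fun z => by positivity) hR hsub
    (by rwa [hNφ])
  rw [hNφ] at hmain
  set J := ∫ z, ‖z‖ ^ a * γ z ^ 2 with hJ_def
  set D := ∫ z, ‖fderiv ℝ f z‖ ^ p with hD_def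
  have hDc : Continuous (fderiv ℝ f) := hf.continuous_fderiv one_ne_zero
  have hDcs : HasCompactSupport fun z => ‖fderiv ℝ f z‖ := (hc.fderiv (𝕜 := ℝ)).norm
  set u : ℂ → ℝ := fun z => |f z| ^ (s - 1) with hu
  have huc : Continuous u := hf.continuous.abs.rpow_const fun _ => Or.inr (by linarith)
  have hucs : HasCompactSupport u :=
    hc.comp_left (g := fun t : ℝ => |t| ^ (s - 1)) (by simp [zero_rpow (by linarith : s - 1 ≠ 0)])
  have hu0 : ∀ z, 0 ≤ u z := fun z => by positivity
  have hmemD : MemLp (fun z => ‖fderiv ℝ f z‖) (ENNReal.ofReal p) :=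
    hDc.norm.memLp_of_hasCompactSupport hDcs
  have hmemT : MemLp (fun z => u z * ‖T z‖) (ENNReal.ofReal a) := by
    refine MemLp.of_le_mul (c := 2 * n) (huc.memLp_of_hasCompactSupport hucs)
      (huc.measurable.mul hTm.norm).aestronglyMeasurable
      (Filter.Eventually.of_forall fun z => ?_)
    rw [norm_mul, norm_norm, mul_comm]
    exact mul_le_mul_of_nonneg_right (hTb z) (norm_nonneg _)
  have hholder := integral_mul_le_Lp_mul_Lq_of_nonneg hpa
    (Filter.Eventually.of_forall fun z => norm_nonneg (fderiv ℝ f z))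
    (Filter.Eventually.of_forall fun z => mul_nonneg (hu0 z) (norm_nonneg (T z))) hmemD hmemT
  have hpow : ∀ z, (u z * ‖T z‖) ^ a = ‖T z‖ ^ a * φ z ^ 2 := fun z => by
    rw [mul_rpow (hu0 z) (norm_nonneg _), hφ2, hu]
    simp only
    rw [← rpow_mul (abs_nonneg _), hsa, mul_comm]
  simp only [hpow] at hholder
  rw [hpush] at hholder
  have hprod : Integrable fun z => ‖fderiv ℝ f z‖ * (u z * ‖T z‖) := by
    have : ENNReal.HolderConjugate (ENNReal.ofReal p) (ENNReal.ofReal a) := hpa.ennrealOfReal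
    exact hmemD.integrable_mul hmemT
  have hint : -(1 / 2) * ∫ z, fderiv ℝ φ z (T z) ≤
      s / 2 * ∫ z, ‖fderiv ℝ f z‖ * (u z * ‖T z‖) := by
    have h1 : |∫ z, fderiv ℝ φ z (T z)| ≤ ∫ z, s * (‖fderiv ℝ f z‖ * (u z * ‖T z‖)) := by
      rw [← norm_eq_abs]
      refine norm_integral_le_of_norm_le (hprod.const_mul s)
        (Filter.Eventually.of_forall fun z => ?_)
      calc ‖fderiv ℝ φ z (T z)‖ ≤ ‖fderiv ℝ φ z‖ * ‖T z‖ := (fderiv ℝ φ z).le_opNorm _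
        _ ≤ s * |f z| ^ (s - 1) * ‖fderiv ℝ f z‖ * ‖T z‖ :=
          mul_le_mul_of_nonneg_right (norm_fderiv_abs_rpow_le hf hs z) (norm_nonneg _)
        _ = s * (‖fderiv ℝ f z‖ * (u z * ‖T z‖)) := by rw [hu]; ring
    rw [integral_const_mul] at h1
    linarith [neg_abs_le (∫ z, fderiv ℝ φ z (T z))]
  have hJB : ∫ z in B, ‖z‖ ^ a * γ z ^ 2 ≤ J := setIntegral_le_integral hγa
    (Filter.Eventually.of_forall fun z => by positivity)
  have hJB0 : 0 ≤ ∫ z in B, ‖z‖ ^ a * γ z ^ 2 := integral_nonneg fun z => by positivity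
  have hD0 : 0 ≤ D := integral_nonneg fun z => by positivity
  set x := N / mB with hx
  have hx0 : 0 < x := div_pos hN hmB
  have hI0 : 0 ≤ ∫ z in B, γ z := integral_nonneg fun z => (hpos z).le
  have hsqrt : √x = x ^ (1 / a) * x ^ (1 / q) := by
    rw [sqrt_eq_rpow, ← rpow_add hx0, ← hqa, add_comm]
  have hfin : x ^ (1 / a) * (x ^ (1 / q) * ∫ z in B, γ z) ≤
      x ^ (1 / a) * (q / 4 * D ^ (1 / p) * J ^ (1 / a)) := by
    calc x ^ (1 / a) * (x ^ (1 / q) * ∫ z in B, γ z) = √x * ∫ z in B, γ z := by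
          rw [hsqrt]; ring
      _ ≤ s / 2 * (D ^ (1 / p) * (x * ∫ z in B, ‖z‖ ^ a * γ z ^ 2) ^ (1 / a)) :=
          (hmain.trans hint).trans (mul_le_mul_of_nonneg_left hholder (by positivity))
      _ ≤ s / 2 * (D ^ (1 / p) * (x * J) ^ (1 / a)) := by gcongr
      _ = x ^ (1 / a) * (q / 4 * D ^ (1 / p) * J ^ (1 / a)) := by
          rw [mul_rpow hx0.le (hJB0.trans hJB), hs_def]; ring
  refine le_trans ?_ (le_of_mul_le_mul_left hfin (rpow_pos_of_pos hx0 _))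
  exact mul_le_mul_of_nonneg_right (rpow_le_rpow (div_nonneg hN.le (hmB.le.trans hmle))
    (div_le_div_of_nonneg_left hN.le hmB hmle) (by positivity)) hI0

theorem iUnion_reProdIm_eq_univ :
    ⋃ k : ℕ, Set.Ioc (-((k : ℝ) + 1)) (k + 1) ×ℂ Set.Ioc (-((k : ℝ) + 1)) (k + 1) =
      Set.univ := by
  refine Set.eq_univ_of_forall fun z => Set.mem_iUnion.2 ?_
  obtain ⟨k, hk⟩ := exists_nat_ge ‖z‖
  have h1 := abs_le.1 ((Complex.abs_re_le_norm z).trans hk)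
  have h2 := abs_le.1 ((Complex.abs_im_le_norm z).trans hk)
  exact ⟨k, ⟨⟨by linarith, by linarith⟩, ⟨by linarith, by linarith⟩⟩⟩

theorem rpow_mul_integral_le_of_transport {f : ℂ → ℝ} (hf : ContDiff ℝ 1 f)
    (hc : HasCompactSupport f) {p a q : ℝ} (hpa : p.HolderConjugate a) (hq : 2 < q)
    (hqa : 1 / q + 1 / a = 1 / 2) (hN : 0 < ∫ z, |f z| ^ q) {γ : ℂ → ℝ} (hγ : Continuous γ)
    (hpos : ∀ z, 0 < γ z) (hγ1 : Integrable γ) (hγ2 : Integrable fun z => γ z ^ 2)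
    (hγa : Integrable fun z => ‖z‖ ^ a * γ z ^ 2) :
    ((∫ z, |f z| ^ q) / ∫ z, γ z ^ 2) ^ (1 / q) * ∫ z, γ z ≤
      q / 4 * (∫ z, ‖fderiv ℝ f z‖ ^ p) ^ (1 / p) * (∫ z, ‖z‖ ^ a * γ z ^ 2) ^ (1 / a) := by
  have hlim := tendsto_setIntegral_of_monotone (μ := volume) (f := γ)
    (s := fun k : ℕ => Set.Ioc (-((k : ℝ) + 1)) (k + 1) ×ℂ Set.Ioc (-((k : ℝ) + 1)) (k + 1))
    (fun k => (Complex.measurable_re measurableSet_Ioc).inter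
      (Complex.measurable_im measurableSet_Ioc)) ?_ hγ1.integrableOn
  · rw [iUnion_reProdIm_eq_univ, setIntegral_univ] at hlim
    exact le_of_tendsto (hlim.const_mul _) (Filter.Eventually.of_forall fun k =>
      rpow_mul_setIntegral_le_of_transport hf hc hpa hq hqa hN hγ hpos hγ2 hγa (by positivity))
  · intro k l hkl
    have : (k : ℝ) ≤ l := by exact_mod_cast hkl
    have h : Set.Ioc (-((k : ℝ) + 1)) (k + 1) ⊆ Set.Ioc (-((l : ℝ) + 1)) (l + 1) :=
      Set.Ioc_subset_Ioc (by linarith) (by linarith)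
    exact fun z hz => ⟨h hz.1, h hz.2⟩

end SobolevInequality

section MainInequality

theorem rpow_integral_abs_rpow_le_talenti {f : ℂ → ℝ} (hf : ContDiff ℝ 1 f)
    (hc : HasCompactSupport f) {p : ℝ} (hp₁ : 1 < p) (hp₂ : p < 2) :
    (∫ z, |f z| ^ (2 * p / (2 - p))) ^ (1 / (2 * p / (2 - p))) ≤
      ((p - 1) / (2 - p)) ^ ((p - 1) / p) /
          (√π * 2 ^ (1 / p) * √(Gamma (2 / p) * Gamma (3 - 2 / p))) *
        (∫ z, ‖fderiv ℝ f z‖ ^ p) ^ (1 / p) := by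
  have hp0 : 0 < p := by linarith
  have hp1 : 0 < p - 1 := by linarith
  have hp2 : 0 < 2 - p := by linarith
  set q := 2 * p / (2 - p) with hq_def
  set a := p / (p - 1) with ha_def
  have hq0 : 0 < q := by positivity
  have hq : 2 < q := by rw [hq_def, lt_div_iff₀ hp2]; linarith
  have ha : 2 < a := by rw [ha_def, lt_div_iff₀ hp1]; linarith
  have ha0 : 0 < a := by linarith
  have hpa : p.HolderConjugate a := Real.HolderConjugate.conjExponent hp₁
  have hqa : 1 / q + 1 / a = 1 / 2 := by
    rw [hq_def, ha_def]; field_simp; ring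
  have hia : 1 / a = (p - 1) / p := by rw [ha_def, one_div_div]
  have hN0 : 0 ≤ ∫ z, |f z| ^ q := integral_nonneg fun z => by positivity
  have h2p : 2 / p < 2 := by rw [div_lt_iff₀ hp0]; linarith
  have hΓ1 : 0 < Gamma (2 / p) := Gamma_pos_of_pos (by positivity)
  have hΓ2 : 0 < Gamma (3 - 2 / p) := Gamma_pos_of_pos (by linarith)
  have hD0 : 0 ≤ ∫ z, ‖fderiv ℝ f z‖ ^ p := integral_nonneg fun z => by positivity
  rcases hN0.eq_or_lt with hN | hN
  · rw [← hN, zero_rpow (one_div_pos.2 hq0).ne']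
    have : 0 ≤ (p - 1) / (2 - p) := by positivity
    positivity
  obtain ⟨hiJ, him, hiI, hm, hI, hJ⟩ := integral_norm_rpow_mul_one_add_norm_rpow ha
  have hy : ∀ z : ℂ, 1 + ‖z‖ ^ a ≠ 0 := fun z => by positivity
  have h := rpow_mul_integral_le_of_transport hf hc hpa hq hqa hN
    (γ := fun z => (1 + ‖z‖ ^ a)⁻¹)
    ((continuous_const.add (continuous_norm.rpow_const fun _ => Or.inr ha0.le)).inv₀ hy)
    (fun z => by positivity) hiI him hiJ
  have e1 : 2 / a + 1 = 3 - 2 / p := by rw [ha_def]; field_simp; ring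
  have e2 : 2 - 2 / a = 2 / p := by rw [ha_def]; field_simp; ring
  have e3 : 1 - 2 / a = 2 / q := by rw [ha_def, hq_def]; field_simp; ring
  rw [e1, e2] at hm
  rw [e3] at hI
  rw [hJ] at h
  set D := (∫ z, ‖fderiv ℝ f z‖ ^ p) ^ (1 / p) with hD
  set N := ∫ z, |f z| ^ q with hN_def
  set m := ∫ z : ℂ, ((1 + ‖z‖ ^ a)⁻¹) ^ 2 with hm_def
  set I := ∫ z : ℂ, (1 + ‖z‖ ^ a)⁻¹ with hI_def
  have hm0 : 0 < m := by rw [hm]; positivity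
  have hIm : I = q / 2 * m := by rw [← hI]; field_simp
  set X := (p - 1) / (2 - p) with hX
  have hX0 : 0 < X := by positivity
  have hJm : 2 / a * I = 2 * X * m := by
    rw [hIm, hX, ha_def, hq_def]; field_simp
  rw [hJm, hIm, div_rpow hN.le hm0.le, mul_rpow (by positivity) hm0.le,
    mul_rpow (by positivity) hX0.le] at h
  have hsq : √π * √(Gamma (2 / p) * Gamma (3 - 2 / p)) = √m := by
    rw [hm, ← sqrt_mul pi_pos.le, mul_comm (Gamma (2 / p))]
  have h2 : (2 : ℝ) ^ (1 / a) * 2 ^ (1 / p) = 2 := by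
    rw [← rpow_add two_pos, hia, show (p - 1) / p + 1 / p = 1 by field_simp; ring, rpow_one]
  have hmm : m ^ (1 / q) * m ^ (1 / a) = √m := by
    rw [← rpow_add hm0, hqa, sqrt_eq_rpow]
  rw [mul_right_comm (√π), hsq, ← hia]
  have hmq : 0 < m ^ (1 / q) := rpow_pos_of_pos hm0 _
  have hsm : √m * √m = m := mul_self_sqrt hm0.le
  have hsm0 : 0 < √m := sqrt_pos.2 hm0
  have h2p0 : (0 : ℝ) < 2 ^ (1 / p) := by positivity
  rw [div_mul_eq_mul_div, div_mul_eq_mul_div, div_le_iff₀ hmq] at h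
  rw [div_mul_eq_mul_div, le_div_iff₀ (by positivity)]
  have h3 : q / 2 * √m * √m * N ^ (1 / q) ≤
      q / 4 * D * (2 ^ (1 / a) * X ^ (1 / a)) * √m := by
    calc q / 2 * √m * √m * N ^ (1 / q) = N ^ (1 / q) * (q / 2 * (√m * √m)) := by ring
      _ = N ^ (1 / q) * (q / 2 * m) := by rw [hsm]
      _ ≤ q / 4 * D * (2 ^ (1 / a) * X ^ (1 / a) * m ^ (1 / a)) * m ^ (1 / q) :=
          le_of_eq_of_le (by ring) h
      _ = q / 4 * D * (2 ^ (1 / a) * X ^ (1 / a)) * (m ^ (1 / q) * m ^ (1 / a)) := by ring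
      _ = q / 4 * D * (2 ^ (1 / a) * X ^ (1 / a)) * √m := by rw [hmm]
  have h4 : 2 * √m * N ^ (1 / q) ≤ 2 ^ (1 / a) * X ^ (1 / a) * D := by
    refine le_of_mul_le_mul_left ?_ (by positivity : 0 < q / 4 * √m)
    linarith
  refine le_of_mul_le_mul_left ?_ (by positivity : (0 : ℝ) < 2 ^ (1 / a))
  calc 2 ^ (1 / a) * (N ^ (1 / q) * (√m * 2 ^ (1 / p)))
      = 2 ^ (1 / a) * 2 ^ (1 / p) * √m * N ^ (1 / q) := by ring
    _ ≤ 2 ^ (1 / a) * X ^ (1 / a) * D := by rw [h2]; exact h4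
    _ = 2 ^ (1 / a) * (X ^ (1 / a) * D) := by ring

theorem rpow_integral_rpow_le_measure_rpow_mul {α : Type*} [MeasurableSpace α] {μ : Measure α}
    [IsFiniteMeasure μ] {u : α → ℝ} (hu : AEStronglyMeasurable u μ) (h0 : ∀ x, 0 ≤ u x) {C : ℝ}
    (hC : ∀ x, u x ≤ C) {s t : ℝ} (hs : 0 < s) (hst : s < t) :
    (∫ x, u x ^ s ∂μ) ^ (1 / s) ≤
      μ.real Set.univ ^ (1 / s - 1 / t) * (∫ x, u x ^ t ∂μ) ^ (1 / t) := by
  have ht : 0 < t := hs.trans hst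
  have hP : 1 < t / s := (one_lt_div hs).2 hst
  have hpq := Real.HolderConjugate.conjExponent hP
  have hmem : MemLp (fun x => u x ^ s) (ENNReal.ofReal (t / s)) μ := by
    refine MemLp.of_bound (hu.aemeasurable.pow_const s).aestronglyMeasurable (C ^ s)
      (Filter.Eventually.of_forall fun x => ?_)
    rw [norm_of_nonneg (rpow_nonneg (h0 x) _)]
    exact rpow_le_rpow (h0 x) (hC x) hs.le
  have h := integral_mul_le_Lp_mul_Lq_of_nonneg hpq
    (Filter.Eventually.of_forall fun x => rpow_nonneg (h0 x) s)
    (Filter.Eventually.of_forall fun _ => zero_le_one) hmem (memLp_const (1 : ℝ))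
  have hpow : ∀ x, (u x ^ s) ^ (t / s) = u x ^ t := fun x => by
    rw [← rpow_mul (h0 x), mul_div_cancel₀ _ hs.ne']
  simp only [hpow, mul_one, one_rpow, integral_const, smul_eq_mul] at h
  have hI0 : 0 ≤ ∫ x, u x ^ s ∂μ := integral_nonneg fun x => rpow_nonneg (h0 x) _
  have hJ0 : 0 ≤ ∫ x, u x ^ t ∂μ := integral_nonneg fun x => rpow_nonneg (h0 x) _
  refine (rpow_le_rpow hI0 h (by positivity)).trans_eq ?_
  rw [mul_rpow (by positivity) (by positivity), ← rpow_mul hJ0, ← rpow_mul measureReal_nonneg,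
    mul_comm]
  congr 2
  · rw [conjExponent]
    have : t - s ≠ 0 := (sub_pos.2 hst).ne'
    field_simp
  · field_simp

end MainInequality

/-- The (non-weighted) Sobolev–Poincaré inequality with explicit constant
(Theorem 3 of the paper), for smooth compactly supported functions on a
nonempty bounded open set `Ω' ⊆ ℂ ≅ ℝ²`. -/
theorem sobolev_poincare_explicit_constant
    (Ω' : Set ℂ) (hne : Ω'.Nonempty) (hopen : IsOpen Ω')
    (hbdd : Bornology.IsBounded Ω')
    (r p : ℝ) (hr : 2 ≤ r) (hp₁ : 2 * r / (r + 2) < p) (hp₂ : p < 2)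
    (f : ℂ → ℝ) (hf : ContDiff ℝ (⊤ : ℕ∞) f)
    (hsupp : IsCompact (tsupport f)) (hsub : tsupport f ⊆ Ω') :
    (∫ x in Ω', |f x| ^ r) ^ (1 / r) ≤
      (((p - 1) / (2 - p)) ^ ((p - 1) / p) * (volume Ω').toReal ^ (1 / r) /
        (Real.sqrt π * (2 : ℝ) ^ (1 / p) *
          Real.sqrt (Real.Gamma (2 / p) * Real.Gamma (3 - 2 / p)))) *
      (∫ x in Ω', ‖fderiv ℝ f x‖ ^ 2) ^ ((1 : ℝ) / 2) := by
  have hf1 : ContDiff ℝ 1 f := hf.of_le (by exact_mod_cast le_top)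
  have hc : HasCompactSupport f := hsupp
  have hr0 : 0 < r := by linarith
  have hp' : 2 * r < p * (r + 2) := (div_lt_iff₀ (by linarith)).1 hp₁
  have hp1 : 1 < p := by nlinarith
  have hp0 : 0 < p := by linarith
  have h2p : 0 < 2 - p := by linarith
  have hX : 0 ≤ (p - 1) / (2 - p) := div_nonneg (by linarith) h2p.le
  have htal := rpow_integral_abs_rpow_le_talenti hf1 hc hp1 hp₂
  set q := 2 * p / (2 - p) with hq
  have hrq : r < q := by rw [hq, lt_div_iff₀ h2p]; linarith
  have hq0 : 0 < q := hr0.trans hrq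
  have hDc : Continuous (fderiv ℝ f) := hf1.continuous_fderiv one_ne_zero
  have hf0 : ∀ z, z ∉ Ω' → f z = 0 := fun z hz =>
    image_eq_zero_of_notMem_tsupport fun h => hz (hsub h)
  have hD0 : ∀ z, z ∉ Ω' → fderiv ℝ f z = 0 := fun z hz => by
    by_contra h
    exact hz (hsub (support_fderiv_subset ℝ h))
  obtain ⟨C₁, hC₁⟩ := hc.exists_bound_of_continuous hf1.continuous
  obtain ⟨C₂, hC₂⟩ := (hc.fderiv (𝕜 := ℝ)).exists_bound_of_continuous hDc
  have : IsFiniteMeasure (volume.restrict Ω') :=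
    ⟨by rw [Measure.restrict_apply_univ]; exact hbdd.measure_lt_top⟩
  have hV : (volume.restrict Ω').real Set.univ = (volume Ω').toReal := by
    rw [measureReal_restrict_apply_univ, measureReal_def]
  have hV0 : 0 < (volume Ω').toReal :=
    ENNReal.toReal_pos (hopen.measure_pos volume hne).ne' hbdd.measure_lt_top.ne
  have h1 := rpow_integral_rpow_le_measure_rpow_mul (μ := volume.restrict Ω')
    (u := fun z => |f z|) hf1.continuous.abs.aestronglyMeasurable (fun _ => abs_nonneg _) hC₁
    hr0 hrq
  have h2 := rpow_integral_rpow_le_measure_rpow_mul (μ := volume.restrict Ω')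
    (u := fun z => ‖fderiv ℝ f z‖) hDc.norm.aestronglyMeasurable (fun _ => norm_nonneg _) hC₂
    hp0 hp₂
  rw [hV] at h1 h2
  rw [setIntegral_eq_integral_of_forall_compl_eq_zero (f := fun z => |f z| ^ q) fun z hz => by
    rw [hf0 z hz, abs_zero, zero_rpow hq0.ne']] at h1
  rw [setIntegral_eq_integral_of_forall_compl_eq_zero (f := fun z => ‖fderiv ℝ f z‖ ^ p)
    fun z hz => by rw [hD0 z hz, norm_zero, zero_rpow hp0.ne']] at h2
  simp only [rpow_two] at h2
  set V := (volume Ω').toReal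
  set K := √π * (2 : ℝ) ^ (1 / p) * √(Gamma (2 / p) * Gamma (3 - 2 / p))
  set E := (∫ z in Ω', ‖fderiv ℝ f z‖ ^ 2) ^ ((1 : ℝ) / 2)
  have hK : 0 ≤ K := by positivity
  have hexp : V ^ (1 / r) = V ^ (1 / r - 1 / q) * V ^ (1 / p - 1 / 2) := by
    rw [← rpow_add hV0]
    congr 1
    rw [hq]
    field_simp
    ring
  calc (∫ x in Ω', |f x| ^ r) ^ (1 / r)
      ≤ V ^ (1 / r - 1 / q) * (∫ z, |f z| ^ q) ^ (1 / q) := h1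
    _ ≤ V ^ (1 / r - 1 / q) * (((p - 1) / (2 - p)) ^ ((p - 1) / p) / K *
          (V ^ (1 / p - 1 / 2) * E)) := by
        refine mul_le_mul_of_nonneg_left (htal.trans ?_) (by positivity)
        exact mul_le_mul_of_nonneg_left h2 (by positivity)
    _ = ((p - 1) / (2 - p)) ^ ((p - 1) / p) * V ^ (1 / r) / K * E := by
        rw [hexp]
        ring
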